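/- For every ε > 0 there exists δ > 0 such that for all sufficiently large k, for every hypergraph H with s_min(H) ≥ k and 1 ≤ q(H) ≤ δ·log k, the random two-phase coloring produces a proper two coloring of H with probability at least 1/3 − ε. -/

import Mathlib

open MeasureTheory Finset
open scoped Classical

/-- The uniform probability measure on `{blue, red}` (blue = `true`, red = `false`). -/
noncomputable def muBool : Measure Bool := (PMF.uniformOfFintype Bool).toMeasure

/-- The uniform probability measure on the interval `(0,1)`. -/
noncomputable def muW : Measure ℝ := volume.restrict (Set.Ioo (0 : ℝ) 1)

/-- The random two-phase coloring model: each vertex independently receives a uniform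
initial color (first component) and a uniform weight in `(0,1)` (second component). -/
noncomputable def muH (V : Type) [Fintype V] : Measure ((V → Bool) × (V → ℝ)) :=
  (Measure.pi fun _ : V => muBool).prod (Measure.pi fun _ : V => muW)

/-- `q(H) = ∑_{f ∈ E} 2^{-|f|+1}`. -/
noncomputable def qH {V : Type} (E : Finset (Finset V)) : ℝ :=
  ∑ f ∈ E, (2 : ℝ) ^ (1 - (f.card : ℤ))

/-- `f` is (initially) monochromatic under `ic`. -/
def Mono {V : Type} (ic : V → Bool) (f : Finset V) : Prop :=
  ∀ u ∈ f, ∀ v ∈ f, ic u = ic v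

/-- Edge `f` is a reason to recolor `v` (given partial final coloring `c`): `v ∈ f ∈ E`,
`f` is initially monochromatic, `v` is the maximum-weight vertex of `f`, and every other
vertex of `f` keeps its initial color. -/
def Reason {V : Type} (E : Finset (Finset V)) (ic : V → Bool) (w : V → ℝ)
    (c : V → Bool) (v : V) : Prop :=
  ∃ f ∈ E, v ∈ f ∧ Mono ic f ∧ (∀ u ∈ f, w u ≤ w v) ∧ ∀ u ∈ f, u ≠ v → c u = ic u

/-- `c` is the final coloring produced by the recoloring procedure (processing vertices in
order of increasing weight): `c v` differs from `ic v` iff there is a reason to recolor `v`.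
For an injective weight function this recurrence determines `c` uniquely. -/
def IsFinalColoring {V : Type} (E : Finset (Finset V)) (ic : V → Bool) (w : V → ℝ)
    (c : V → Bool) : Prop :=
  ∀ v, (Reason E ic w c v → c v = !(ic v)) ∧ (¬ Reason E ic w c v → c v = ic v)

/-- Bad event `A`: more than `αA·q` edges are initially monochromatic. -/
def BadA {V : Type} (E : Finset (Finset V)) (aA q : ℝ) (ic : V → Bool) : Prop :=
  aA * q < ((E.filter fun f => Mono ic f).card : ℝ)

/-- Bad event `B`: some edge `f` is light, i.e. initially monochromatic with all weights
below `1 − p_{|f|}` where `p_j = ln(αB·q)/j`. -/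
def BadB {V : Type} (E : Finset (Finset V)) (aB q : ℝ) (ic : V → Bool) (w : V → ℝ) : Prop :=
  ∃ f ∈ E, Mono ic f ∧ ∀ v ∈ f, w v < 1 - Real.log (aB * q) / (f.card : ℝ)

/-- `f` is almost monochromatic under `ic`. -/
def AlmostMono {V : Type} (ic : V → Bool) (f : Finset V) : Prop :=
  ∃ v ∈ f, ∀ u ∈ f, u ≠ v → ∀ u' ∈ f, u' ≠ v → ic u = ic u'

/-- Bad event `C`: `∑_j Q_j/j > αC·q`, where `Q_j` is the number of almost monochromatic
edges of size `j` (the sum below is over the almost monochromatic edges, weighted `1/|f|`). -/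
def BadC {V : Type} (E : Finset (Finset V)) (aC q : ℝ) (ic : V → Bool) : Prop :=
  aC * q < ∑ f ∈ E.filter fun f => AlmostMono ic f, (1 : ℝ) / (f.card : ℝ)

/-- The second-largest weight among the vertices of `f`. -/
noncomputable def secondWeight {V : Type} [DecidableEq V] (f : Finset V) (w : V → ℝ) : ℝ :=
  sSup ((f.offDiag.image fun p => min (w p.1) (w p.2) : Finset ℝ) : Set ℝ)

/-- The second weight deficit `d₂(f) := (|f|+1)(1 − w₂(f))` for initially monochromatic `f`,
and `0` otherwise. -/
noncomputable def d2 {V : Type} [DecidableEq V] (f : Finset V) (ic : V → Bool)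
    (w : V → ℝ) : ℝ :=
  if Mono ic f then ((f.card : ℝ) + 1) * (1 - secondWeight f w) else 0

/-- Bad event `D`: `∑_{f ∈ E} d₂(f) > αD·q`. -/
def BadD {V : Type} [DecidableEq V] (E : Finset (Finset V)) (aD q : ℝ) (ic : V → Bool)
    (w : V → ℝ) : Prop :=
  aD * q < ∑ f ∈ E, d2 f ic w

/-- Sequential exposure bound: `D x` is a set of vertices whose membership at `u` depends only on
the colors of vertices lighter than `u`.  Colorings that agree with `g` on a predictable set of
size at least `m - n` form at most a `2 ^ (n - m)` fraction of all colorings. -/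
theorem card_mul_two_pow_le_of_predictable {V : Type} [Fintype V] (w : V → ℝ)
    (D : (V → Bool) → Finset V)
    (hD : ∀ x y u, (∀ t, w t < w u → x t = y t) → u ∈ D x → u ∈ D y)
    (g : V → Bool) (A : Finset (V → Bool)) (m n : ℕ)
    (hA : ∀ x ∈ A, (∀ u ∈ D x, x u = g u) ∧ m ≤ (D x).card + n) :
    A.card * 2 ^ m ≤ 2 ^ (Fintype.card V + n) := by
  let F : (V → Bool) → Finset (V → Bool) := fun x =>
    Fintype.piFinset fun u => if u ∈ D x then (univ : Finset Bool) else {x u}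
  have hF : ∀ x y, y ∈ F x ↔ ∀ u, u ∉ D x → y u = x u := by
    intro x y
    simp only [F, Fintype.mem_piFinset]
    refine forall_congr' fun u => ?_
    by_cases h : u ∈ D x <;> simp [h]
  have hFcard : ∀ x, (F x).card = 2 ^ (D x).card := by
    intro x
    have h : ∀ u, (if u ∈ D x then (univ : Finset Bool) else {x u}).card
        = if u ∈ D x then 2 else 1 := by
      intro u; split_ifs <;> simp
    simp only [F, Fintype.card_piFinset, h]
    simp
  have hdisj : ∀ x ∈ A, ∀ y ∈ A, x ≠ y → Disjoint (F x) (F y) := by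
    intro x hx y hy hxy
    rw [Finset.disjoint_left]
    intro z hzx hzy
    rw [hF] at hzx hzy
    obtain ⟨u₀, hu₀⟩ := Function.ne_iff.mp hxy
    obtain ⟨u, hu, hmin⟩ := Finset.exists_min_image (univ.filter fun u => x u ≠ y u) w
      ⟨u₀, by simpa using hu₀⟩
    have hu' : x u ≠ y u := by simpa using hu
    have hlow : ∀ t, w t < w u → x t = y t := by
      intro t ht
      by_contra hne
      exact absurd (hmin t (by simpa using hne)) (not_le.mpr ht)
    by_cases h : u ∈ D x
    · have h' := hD x y u hlow h
      exact hu' (((hA x hx).1 u h).trans ((hA y hy).1 u h').symm)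
    · have h' : u ∉ D y := fun h' => h (hD y x u (fun t ht => (hlow t ht).symm) h')
      exact hu' ((hzx u h).symm.trans (hzy u h'))
  have hsum : ∑ x ∈ A, 2 ^ (D x).card ≤ 2 ^ Fintype.card V := by
    calc ∑ x ∈ A, 2 ^ (D x).card = (A.biUnion F).card := by
          rw [Finset.card_biUnion hdisj]
          exact Finset.sum_congr rfl fun x _ => (hFcard x).symm
      _ ≤ Fintype.card (V → Bool) := Finset.card_le_univ _
      _ = 2 ^ Fintype.card V := by simp
  calc A.card * 2 ^ m = ∑ x ∈ A, 2 ^ m := by simp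
    _ ≤ ∑ x ∈ A, 2 ^ (D x).card * 2 ^ n := by
        refine Finset.sum_le_sum fun x hx => ?_
        rw [← pow_add]
        exact Nat.pow_le_pow_right (by norm_num) (hA x hx).2
    _ = (∑ x ∈ A, 2 ^ (D x).card) * 2 ^ n := by rw [Finset.sum_mul]
    _ ≤ 2 ^ (Fintype.card V + n) := by
        rw [pow_add]; exact Nat.mul_le_mul_right _ hsum

theorem muBool_singleton (b : Bool) : muBool {b} = 2⁻¹ := by
  unfold muBool
  rw [PMF.toMeasure_apply_singleton _ _ (measurableSet_singleton _)]
  simp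

instance : IsProbabilityMeasure muBool := by unfold muBool; infer_instance

instance : IsProbabilityMeasure muW := ⟨by simp [muW]⟩

instance (V : Type) [Fintype V] : IsProbabilityMeasure (muH V) := by
  unfold muH; infer_instance

theorem pi_muBool_apply {V : Type} [Fintype V] (A : Set (V → Bool)) :
    (Measure.pi fun _ : V => muBool) A
      = ENNReal.ofReal ((univ.filter (· ∈ A)).card / 2 ^ Fintype.card V) := by
  have h1 : A = ((univ.filter (· ∈ A) : Finset (V → Bool)) : Set (V → Bool)) := by ext; simp
  have h2 : ∀ x : V → Bool, (Measure.pi fun _ : V => muBool) {x}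
      = ENNReal.ofReal ((2 ^ Fintype.card V)⁻¹) := by
    intro x
    rw [Measure.pi_singleton, ENNReal.ofReal_inv_of_pos (by positivity),
      ENNReal.ofReal_pow (by norm_num)]
    simp only [muBool_singleton, Finset.prod_const, Finset.card_univ, ENNReal.ofReal_ofNat]
    rw [ENNReal.inv_pow]
  conv_lhs => rw [h1]
  rw [← sum_measure_singleton, Finset.sum_congr rfl fun x _ => h2 x, Finset.sum_const, nsmul_eq_mul]
  rw [div_eq_mul_inv, ENNReal.ofReal_mul (Nat.cast_nonneg _), ENNReal.ofReal_natCast]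

/-- Almost surely all the weights are distinct. -/
theorem ae_injective_muW (V : Type) [Fintype V] :
    ∀ᵐ w ∂(Measure.pi fun _ : V => muW), Function.Injective w := by
  have h : ∀ u v : V, u ≠ v → ∀ᵐ w ∂(Measure.pi fun _ : V => muW), w u ≠ w v := by
    intro u v huv
    unfold muW
    rw [← Measure.restrict_pi_pi]
    refine ae_restrict_of_ae ?_
    let S : Submodule ℝ (V → ℝ) :=
      LinearMap.ker (LinearMap.proj (R := ℝ) (φ := fun _ : V => ℝ) u - LinearMap.proj v)
    have hS : S ≠ ⊤ := by
      intro htop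
      have : (Pi.single u 1 : V → ℝ) ∈ S := htop ▸ Submodule.mem_top
      simp [S, huv.symm] at this
    have := Measure.addHaar_submodule (volume : Measure (V → ℝ)) S hS
    have hset : {w : V → ℝ | ¬ w u ≠ w v} = (S : Set (V → ℝ)) := by
      ext w
      simp [S, sub_eq_zero]
    rw [ae_iff, hset, ← volume_pi]
    exact this
  have h' : ∀ᵐ w ∂(Measure.pi fun _ : V => muW), ∀ u v : V, u ≠ v → w u ≠ w v := by
    simp only [Filter.eventually_all]
    exact fun u v huv => h u v huv
  filter_upwards [h'] with w hw u v huv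
  by_contra hne
  exact hw u v hne huv

/-- A property of the weights that only depends on their relative order is measurable. -/
theorem measurableSet_of_order {V : Type} [Fintype V] (P : (V → ℝ) → Prop)
    (hP : ∀ w w', (∀ u v, w u ≤ w v ↔ w' u ≤ w' v) → P w → P w') :
    MeasurableSet {w : V → ℝ | P w} := by
  let r : (V → ℝ) → V × V → Bool := fun w p => decide (w p.1 ≤ w p.2)
  have hm : Measurable r := by
    refine measurable_pi_lambda _ fun p => measurable_to_bool ?_
    have : (fun w : V → ℝ => decide (w p.1 ≤ w p.2)) ⁻¹' {true} = {w | w p.1 ≤ w p.2} := by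
      ext; simp
    exact this ▸ measurableSet_le (measurable_pi_apply _) (measurable_pi_apply _)
  have hset : {w : V → ℝ | P w} = r ⁻¹' (r '' {w | P w}) := by
    refine (Set.subset_preimage_image _ _).antisymm ?_
    rintro w ⟨w', hw', hr⟩
    refine hP w' w (fun u v => ?_) hw'
    simpa [r] using congrFun hr (u, v)
  rw [hset]
  exact hm (Set.toFinite _).measurableSet

/-- `v` is a heaviest vertex of `e`. -/
def IsHeaviest {V : Type} (w : V → ℝ) (e : Finset V) (v : V) : Prop :=
  v ∈ e ∧ ∀ u ∈ e, w u ≤ w v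

theorem IsHeaviest.congr_order {V : Type} {w w' : V → ℝ}
    (h : ∀ u v, w u ≤ w v ↔ w' u ≤ w' v) : IsHeaviest w = IsHeaviest w' := by
  funext e v
  simp [IsHeaviest, h]

theorem IsHeaviest.eq {V : Type} {w : V → ℝ} (hw : Function.Injective w) {e : Finset V} {u v : V}
    (hu : IsHeaviest w e u) (hv : IsHeaviest w e v) : u = v :=
  hw (le_antisymm (hv.2 _ hu.1) (hu.2 _ hv.1))

theorem measurableSet_isHeaviest {V : Type} [Fintype V] (e : Finset V) (v : V) :
    MeasurableSet {w : V → ℝ | IsHeaviest w e v} :=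
  measurableSet_of_order _ fun _ _ h hw => IsHeaviest.congr_order h ▸ hw

/-- Each vertex of `e` is equally likely to be the heaviest one. -/
theorem measure_isHeaviest_le {V : Type} [Fintype V] (e : Finset V) (v : V) :
    (Measure.pi fun _ : V => muW) {w | IsHeaviest w e v} ≤ ENNReal.ofReal (1 / e.card) := by
  by_cases hv : v ∈ e
  swap
  · simp [IsHeaviest, hv]
  set μ := Measure.pi fun _ : V => muW
  have hsymm : ∀ u ∈ e, μ {w | IsHeaviest w e u} = μ {w | IsHeaviest w e v} := by
    intro u hu
    have hmp := measurePreserving_piCongrLeft (fun _ : V => muW) (Equiv.swap u v)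
    rw [← hmp.measure_preimage (measurableSet_isHeaviest e v).nullMeasurableSet]
    congr 1
    ext w
    have hval : ∀ t, (MeasurableEquiv.piCongrLeft (fun _ : V => ℝ) (Equiv.swap u v)) w t
        = w (Equiv.swap u v t) := by
      intro t
      conv_lhs => rw [← Equiv.swap_apply_self u v t]
      rw [MeasurableEquiv.piCongrLeft_apply_apply]
    have hmem : ∀ t, Equiv.swap u v t ∈ e ↔ t ∈ e := by
      intro t
      rcases eq_or_ne t u with rfl | h1
      · simp [hu, hv]
      rcases eq_or_ne t v with rfl | h2
      · simp [hu, hv]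
      rw [Equiv.swap_apply_of_ne_of_ne h1 h2]
    simp only [IsHeaviest, Set.mem_ofPred_eq, Set.mem_preimage, hval, Equiv.swap_apply_right, hu,
      hv, true_and]
    constructor
    · intro h t ht
      exact h _ ((hmem t).mpr ht)
    · intro h t ht
      have := h _ ((hmem t).mpr ht)
      simpa using this
  have hdisj : ∀ u₁ ∈ e, ∀ u₂ ∈ e, u₁ ≠ u₂ →
      AEDisjoint μ {w | IsHeaviest w e u₁} {w | IsHeaviest w e u₂} := by
    intro u₁ _ u₂ _ hne
    have := ae_injective_muW V
    rw [ae_iff] at this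
    refine measure_mono_null ?_ this
    rintro w ⟨h1, h2⟩ hinj
    exact hne (h1.eq hinj h2)
  have hsum : ∑ u ∈ e, μ {w | IsHeaviest w e u} ≤ 1 := by
    rw [← measure_biUnion_finset₀ (fun a ha b hb hab => hdisj a ha b hb hab)
      fun u _ => (measurableSet_isHeaviest e u).nullMeasurableSet]
    exact prob_le_one
  rw [Finset.sum_congr rfl hsymm, Finset.sum_const, nsmul_eq_mul] at hsum
  have hpos : (0 : ℝ) < e.card := by exact_mod_cast Finset.card_pos.mpr ⟨v, hv⟩
  rw [one_div, ENNReal.ofReal_inv_of_pos hpos, ENNReal.ofReal_natCast,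
    ENNReal.le_inv_iff_mul_le, mul_comm]
  exact hsum

/-- Fubini bound: first average over the initial colors, then over the weights. -/
theorem muH_le {V : Type} [Fintype V] (P : (V → Bool) → (V → ℝ) → Prop)
    (hP : ∀ ic, MeasurableSet {w | P ic w}) (M : Set (V → ℝ)) (hM : MeasurableSet M) (c : ℝ)
    (hPM : ∀ ic w, P ic w → w ∈ M)
    (hc : ∀ w, Function.Injective w →
      ((univ.filter fun ic => P ic w).card : ℝ) ≤ c * 2 ^ Fintype.card V) :
    muH V {ω | P ω.1 ω.2} ≤ ENNReal.ofReal c * (Measure.pi fun _ : V => muW) M := by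
  have hS : MeasurableSet {ω : (V → Bool) × (V → ℝ) | P ω.1 ω.2} := by
    have : {ω : (V → Bool) × (V → ℝ) | P ω.1 ω.2} = ⋃ ic, {ic} ×ˢ {w | P ic w} := by
      ext ⟨a, b⟩; simp
    rw [this]
    exact MeasurableSet.iUnion fun ic => (measurableSet_singleton ic).prod (hP ic)
  unfold muH
  rw [Measure.prod_apply_symm hS, ← lintegral_indicator_const hM]
  refine lintegral_mono_ae ?_
  filter_upwards [ae_injective_muW V] with w hw
  by_cases hwM : w ∈ M
  · rw [Set.indicator_of_mem hwM, pi_muBool_apply]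
    refine ENNReal.ofReal_le_ofReal ?_
    rw [div_le_iff₀ (by positivity)]
    simpa using hc w hw
  · have : (fun x => (x, w)) ⁻¹' {ω : (V → Bool) × (V → ℝ) | P ω.1 ω.2} = ∅ := by
      ext ic
      simpa using fun h => hwM (hPM ic w h)
    simp [this]

/-- The vertices that are heaviest in some edge all of whose other vertices share one initial
color.  Only such vertices can be recolored. -/
noncomputable def freeVertices {V : Type} [Fintype V] (E : Finset (Finset V)) (ic : V → Bool)
    (w : V → ℝ) : Finset V :=
  univ.filter fun v => ∃ e ∈ E, IsHeaviest w e v ∧ ∃ b, ∀ u ∈ e, u ≠ v → ic u = b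

theorem mem_freeVertices {V : Type} [Fintype V] {E : Finset (Finset V)} {ic : V → Bool}
    {w : V → ℝ} {v : V} : v ∈ freeVertices E ic w ↔
      ∃ e ∈ E, IsHeaviest w e v ∧ ∃ b, ∀ u ∈ e, u ≠ v → ic u = b := by
  simp [freeVertices]

theorem freeVertices_congr_order {V : Type} [Fintype V] {w w' : V → ℝ}
    (h : ∀ u v, w u ≤ w v ↔ w' u ≤ w' v) (E : Finset (Finset V)) (ic : V → Bool) :
    freeVertices E ic w = freeVertices E ic w' := by
  simp only [freeVertices, IsHeaviest.congr_order h]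

theorem mem_freeVertices_of_lighter_eq {V : Type} [Fintype V] {E : Finset (Finset V)}
    {w : V → ℝ} (hw : Function.Injective w) {x y : V → Bool} {v : V}
    (hxy : ∀ t, w t < w v → x t = y t) (hv : v ∈ freeVertices E x w) :
    v ∈ freeVertices E y w := by
  rw [mem_freeVertices] at hv ⊢
  obtain ⟨e, he, hev, b, hb⟩ := hv
  refine ⟨e, he, hev, b, fun u hu huv => ?_⟩
  rw [← hxy u (lt_of_le_of_ne (hev.2 u hu) (hw.ne huv))]
  exact hb u hu huv

theorem card_filter_isHeaviest_almost_le {V : Type} [Fintype V] {w : V → ℝ}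
    (hw : Function.Injective w) (e : Finset V) :
    ((univ.filter fun ic : V → Bool =>
      ∃ v, IsHeaviest w e v ∧ ∃ b, ∀ u ∈ e, u ≠ v → ic u = b).card : ℝ)
      ≤ 2 * (2 : ℝ) ^ (1 - (e.card : ℤ)) * 2 ^ Fintype.card V := by
  by_cases hex : ∃ v, IsHeaviest w e v
  swap
  · have : (univ.filter fun ic : V → Bool =>
        ∃ v, IsHeaviest w e v ∧ ∃ b, ∀ u ∈ e, u ≠ v → ic u = b) = ∅ := by
      ext ic
      simp only [mem_filter, mem_univ, true_and, notMem_empty, iff_false]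
      exact fun ⟨v, hv, _⟩ => hex ⟨v, hv⟩
    rw [this]
    simp only [card_empty, Nat.cast_zero]
    positivity
  obtain ⟨v, hv⟩ := hex
  let A : Bool → Finset (V → Bool) := fun b => univ.filter fun ic => ∀ u ∈ e, u ≠ v → ic u = b
  have hA : ∀ b, (A b).card * 2 ^ e.card ≤ 2 ^ (Fintype.card V + 1) := fun b =>
    card_mul_two_pow_le_of_predictable w (fun _ => e.erase v) (fun _ _ _ _ h => h) (fun _ => b)
      (A b) e.card 1 fun x hx => by
        refine ⟨fun u hu => ?_, ?_⟩
        · rw [Finset.mem_erase] at hu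
          exact (Finset.mem_filter.mp hx).2 u hu.2 hu.1
        · rw [Finset.card_erase_add_one hv.1]
  have hsub : (univ.filter fun ic : V → Bool =>
      ∃ v, IsHeaviest w e v ∧ ∃ b, ∀ u ∈ e, u ≠ v → ic u = b) ⊆ A true ∪ A false := by
    intro ic hic
    obtain ⟨v', hv', b, hb⟩ := (Finset.mem_filter.mp hic).2
    obtain rfl := hv.eq hw hv'
    cases b
    · exact Finset.mem_union_right _ (by simpa [A] using hb)
    · exact Finset.mem_union_left _ (by simpa [A] using hb)
  have hcard := (Finset.card_le_card hsub).trans (Finset.card_union_le _ _)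
  have htot : (univ.filter fun ic : V → Bool =>
      ∃ v, IsHeaviest w e v ∧ ∃ b, ∀ u ∈ e, u ≠ v → ic u = b).card * 2 ^ e.card
      ≤ 2 * 2 ^ (Fintype.card V + 1) := by
    calc _ ≤ ((A true).card + (A false).card) * 2 ^ e.card := Nat.mul_le_mul_right _ hcard
      _ ≤ _ := by linarith [hA true, hA false]
  rw [zpow_sub₀ two_ne_zero, zpow_one, zpow_natCast, mul_div_assoc', div_mul_eq_mul_div,
    le_div_iff₀ (by positivity)]
  have : _ ≤ ((2 * 2 ^ (Fintype.card V + 1) : ℕ) : ℝ) := Nat.cast_le.mpr htot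
  push_cast at this
  rw [pow_succ] at this
  linarith

theorem card_freeVertices_le {V : Type} [Fintype V] (E : Finset (Finset V)) (ic : V → Bool)
    {w : V → ℝ} (hw : Function.Injective w) :
    (freeVertices E ic w).card ≤ (E.filter fun e =>
      ∃ v, IsHeaviest w e v ∧ ∃ b, ∀ u ∈ e, u ≠ v → ic u = b).card := by
  have hsub : freeVertices E ic w ⊆ (E.filter fun e =>
      ∃ v, IsHeaviest w e v ∧ ∃ b, ∀ u ∈ e, u ≠ v → ic u = b).biUnion
        fun e => univ.filter (IsHeaviest w e) := by
    intro v hv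
    obtain ⟨e, he, hev, hb⟩ := mem_freeVertices.mp hv
    simp only [Finset.mem_biUnion, Finset.mem_filter, Finset.mem_univ, true_and]
    exact ⟨e, ⟨he, v, hev, hb⟩, hev⟩
  refine (Finset.card_le_card hsub).trans ?_
  refine (Finset.card_biUnion_le_card_mul _ _ 1 fun e _ => ?_).trans_eq (mul_one _)
  rw [Finset.card_le_one]
  intro a ha b hb
  exact (Finset.mem_filter.mp ha).2.eq hw (Finset.mem_filter.mp hb).2

theorem card_filter_lt_card_freeVertices_le {V : Type} [Fintype V] (E : Finset (Finset V))
    {w : V → ℝ} (hw : Function.Injective w) {n : ℕ} (hn : 0 < n) :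
    ((univ.filter fun ic : V → Bool => n < (freeVertices E ic w).card).card : ℝ)
      ≤ 2 * qH E / n * 2 ^ Fintype.card V := by
  have hn' : (0 : ℝ) < n := by exact_mod_cast hn
  have hmarkov : (univ.filter fun ic : V → Bool => n < (freeVertices E ic w).card).card * n
      ≤ ∑ ic : V → Bool, (freeVertices E ic w).card := by
    calc _ = ∑ ic ∈ univ.filter fun ic : V → Bool => n < (freeVertices E ic w).card, n := by simp
      _ ≤ ∑ ic ∈ univ.filter fun ic : V → Bool => n < (freeVertices E ic w).card,
          (freeVertices E ic w).card :=
        Finset.sum_le_sum fun ic hic => (Finset.mem_filter.mp hic).2.le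
      _ ≤ _ := Finset.sum_le_sum_of_subset (Finset.filter_subset _ _)
  have hsum : ((∑ ic : V → Bool, (freeVertices E ic w).card : ℕ) : ℝ)
      ≤ 2 * qH E * 2 ^ Fintype.card V := by
    calc ((∑ ic : V → Bool, (freeVertices E ic w).card : ℕ) : ℝ)
        ≤ ((∑ ic : V → Bool, (E.filter fun e =>
          ∃ v, IsHeaviest w e v ∧ ∃ b, ∀ u ∈ e, u ≠ v → ic u = b).card : ℕ) : ℝ) :=
          Nat.cast_le.mpr (Finset.sum_le_sum fun ic _ => card_freeVertices_le E ic hw)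
      _ = ∑ e ∈ E, ((univ.filter fun ic : V → Bool =>
          ∃ v, IsHeaviest w e v ∧ ∃ b, ∀ u ∈ e, u ≠ v → ic u = b).card : ℝ) := by
          simp only [Finset.card_filter]
          rw [Finset.sum_comm]
          push_cast
          rfl
      _ ≤ ∑ e ∈ E, 2 * (2 : ℝ) ^ (1 - (e.card : ℤ)) * 2 ^ Fintype.card V :=
          Finset.sum_le_sum fun e _ => card_filter_isHeaviest_almost_le hw e
      _ = _ := by rw [qH, Finset.mul_sum, Finset.sum_mul]
  rw [div_mul_eq_mul_div, le_div_iff₀ hn']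
  exact le_trans (by exact_mod_cast hmarkov) hsum

/-- There are at most `n` free vertices, the edge `e` is initially monochromatic of color `b` and
meets `f` only in its heaviest vertex, and all non-free vertices of `f` have the other color. -/
def Conflict {V : Type} [Fintype V] (E : Finset (Finset V)) (n : ℕ) (e f : Finset V) (b : Bool)
    (ic : V → Bool) (w : V → ℝ) : Prop :=
  (freeVertices E ic w).card ≤ n ∧ (∃ v, e ∩ f = {v} ∧ IsHeaviest w e v) ∧ (∀ u ∈ e, ic u = b) ∧
    ∀ u ∈ f, u ∉ freeVertices E ic w → ic u = !b

theorem card_filter_conflict_le {V : Type} [Fintype V] (E : Finset (Finset V)) {w : V → ℝ}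
    (hw : Function.Injective w) (n : ℕ) (e f : Finset V) (b : Bool) :
    ((univ.filter fun ic : V → Bool => Conflict E n e f b ic w).card : ℝ)
      ≤ 2 ^ n / 2 * (2 : ℝ) ^ (1 - (e.card : ℤ)) * (2 : ℝ) ^ (1 - (f.card : ℤ))
        * 2 ^ Fintype.card V := by
  have hcount := card_mul_two_pow_le_of_predictable w (fun ic => e ∪ (f \ freeVertices E ic w))
    (fun x y u hxy hu => by
      simp only [Finset.mem_union, Finset.mem_sdiff] at hu ⊢
      refine hu.imp_right fun h => ⟨h.1, fun h' => h.2 ?_⟩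
      exact mem_freeVertices_of_lighter_eq hw (fun t ht => (hxy t ht).symm) h')
    (fun u => if u ∈ e then b else !b)
    (univ.filter fun ic : V → Bool => Conflict E n e f b ic w) (e.card + f.card) (n + 1)
    (fun ic hic => by
      obtain ⟨hn, ⟨v, hv, -⟩, he, hf⟩ := (Finset.mem_filter.mp hic).2
      refine ⟨fun u hu => ?_, ?_⟩
      · by_cases hue : u ∈ e
        · simp [hue, he u hue]
        · simp only [Finset.mem_union, hue, Finset.mem_sdiff, false_or] at hu
          simp [hue, hf u hu.1 hu.2]
      · have h1 := Finset.card_union_add_card_inter e f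
        rw [hv, Finset.card_singleton] at h1
        have h2 : e ∪ f ⊆ (e ∪ (f \ freeVertices E ic w)) ∪ freeVertices E ic w := by
          intro u hu
          simp only [Finset.mem_union, Finset.mem_sdiff] at hu ⊢
          tauto
        have h3 := (Finset.card_le_card h2).trans (Finset.card_union_le _ _)
        omega)
  have hreal := (Nat.cast_le (α := ℝ)).mpr hcount
  push_cast at hreal
  rw [zpow_sub₀ two_ne_zero, zpow_sub₀ two_ne_zero, zpow_one, zpow_natCast, zpow_natCast]
  rw [← le_div_iff₀ (by positivity)] at hreal
  refine hreal.trans_eq ?_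
  field_simp
  ring

theorem measurableSet_lt_card_freeVertices {V : Type} [Fintype V] (E : Finset (Finset V)) (n : ℕ)
    (ic : V → Bool) : MeasurableSet {w : V → ℝ | n < (freeVertices E ic w).card} :=
  measurableSet_of_order _ fun w w' h hw => by
    rwa [← freeVertices_congr_order h E ic]

theorem measurableSet_conflict {V : Type} [Fintype V] (E : Finset (Finset V)) (n : ℕ)
    (e f : Finset V) (b : Bool) (ic : V → Bool) :
    MeasurableSet {w : V → ℝ | Conflict E n e f b ic w} :=
  measurableSet_of_order _ fun w w' h hw => by
    unfold Conflict at hw ⊢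
    rwa [← freeVertices_congr_order h E ic, ← IsHeaviest.congr_order h]

theorem muH_lt_card_freeVertices_le {V : Type} [Fintype V] (E : Finset (Finset V)) {n : ℕ}
    (hn : 0 < n) :
    muH V {ω | n < (freeVertices E ω.1 ω.2).card} ≤ ENNReal.ofReal (2 * qH E / n) := by
  have h := muH_le (fun ic w => n < (freeVertices E ic w).card)
    (measurableSet_lt_card_freeVertices E n) Set.univ MeasurableSet.univ (2 * qH E / n)
    (fun _ _ _ => Set.mem_univ _) fun w hw => by
      convert card_filter_lt_card_freeVertices_le E hw hn
  simpa using h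

theorem muH_conflict_le {V : Type} [Fintype V] (E : Finset (Finset V)) (n : ℕ) (e f : Finset V)
    (b : Bool) :
    muH V {ω | Conflict E n e f b ω.1 ω.2} ≤ ENNReal.ofReal
      (2 ^ n / 2 * (2 : ℝ) ^ (1 - (e.card : ℤ)) * (2 : ℝ) ^ (1 - (f.card : ℤ)) / e.card) := by
  by_cases hex : ∃ v, e ∩ f = {v}
  swap
  · have : {ω : (V → Bool) × (V → ℝ) | Conflict E n e f b ω.1 ω.2} = ∅ := by
      ext ω
      simpa using fun h : Conflict E n e f b ω.1 ω.2 => hex (h.2.1.imp fun _ hv => hv.1)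
    simp [this]
  obtain ⟨v, hv⟩ := hex
  have h := muH_le (Conflict E n e f b) (measurableSet_conflict E n e f b)
    {w | IsHeaviest w e v} (measurableSet_isHeaviest e v) _
    (fun ic w hc => by
      obtain ⟨v', hv', hh⟩ := hc.2.1
      obtain rfl : v = v' := Finset.singleton_injective (hv.symm.trans hv')
      exact hh)
    fun w hw => card_filter_conflict_le E hw n e f b
  refine h.trans ((mul_le_mul' le_rfl (measure_isHeaviest_le e v)).trans_eq ?_)
  rw [← ENNReal.ofReal_mul (by positivity), ← div_eq_mul_one_div]

theorem exists_conflict_of_monochromatic {V : Type} [Fintype V] {E : Finset (Finset V)}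
    {ic : V → Bool} {w : V → ℝ} {c : V → Bool} (hc : IsFinalColoring E ic w c) {n : ℕ}
    (hn : (freeVertices E ic w).card ≤ n) {f : Finset V} (hf : f ∈ E) (hne : f.Nonempty)
    {b : Bool} (hb : ∀ v ∈ f, c v = b) : ∃ e ∈ E, Conflict E n e f (!b) ic w := by
  have hreason : ∀ v, c v ≠ ic v → Reason E ic w c v := fun v hv => by
    by_contra h
    exact hv ((hc v).2 h)
  have hfree : ∀ v, c v ≠ ic v → v ∈ freeVertices E ic w := fun v hv => by
    obtain ⟨e, he, hve, hmono, hmax, -⟩ := hreason v hv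
    exact mem_freeVertices.mpr ⟨e, he, ⟨hve, hmax⟩, ic v, fun u hu _ => hmono u hu v hve⟩
  by_cases hinit : ∃ v ∈ f, ic v ≠ b
  · obtain ⟨v, hvf, hvb⟩ := hinit
    have hv : ic v = !b := Bool.eq_not.mpr hvb
    obtain ⟨e, he, hve, hmono, hmax, hkeep⟩ := hreason v fun h => hvb (h.symm.trans (hb v hvf))
    have heb : ∀ u ∈ e, ic u = !b := fun u hu => (hmono u hu v hve).trans hv
    refine ⟨e, he, hn, ⟨v, ?_, hve, hmax⟩, heb, fun u hu hnot => ?_⟩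
    · ext u
      simp only [Finset.mem_inter, Finset.mem_singleton]
      refine ⟨fun ⟨hue, huf⟩ => ?_, fun h => h ▸ ⟨hve, hvf⟩⟩
      by_contra huv
      have h1 := hkeep u hue huv
      rw [hb u huf, heb u hue] at h1
      cases b <;> simp at h1
    · have : c u = ic u := by
        by_contra h
        exact hnot (hfree u h)
      rw [← this, hb u hu, Bool.not_not]
  · push Not at hinit
    obtain ⟨v, hv, hmax⟩ := f.exists_max_image w hne
    have hr : Reason E ic w c v :=
      ⟨f, hf, hv, fun u hu t ht => (hinit u hu).trans (hinit t ht).symm, hmax,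
        fun u hu _ => (hb u hu).trans (hinit u hu).symm⟩
    have h1 := (hc v).1 hr
    rw [hb v hv, hinit v hv] at h1
    cases b <;> simp at h1

/-- The failure probability is at most `2 q / n + 2 ^ n q ^ 2 / k`. -/
theorem muH_not_proper_le {V : Type} [Fintype V] {E : Finset (Finset V)} {k n : ℕ} (hk : 0 < k)
    (hn : 0 < n) (hE : ∀ f ∈ E, k ≤ f.card) {C : (V → Bool) → (V → ℝ) → (V → Bool)}
    (hC : ∀ ic w, Function.Injective w → IsFinalColoring E ic w (C ic w)) :
    muH V {ω : (V → Bool) × (V → ℝ) |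
        ∀ f ∈ E, (∃ v ∈ f, C ω.1 ω.2 v = true) ∧ (∃ v ∈ f, C ω.1 ω.2 v = false)}ᶜ
      ≤ ENNReal.ofReal (2 * qH E / n + 2 ^ n * qH E ^ 2 / k) := by
  have hq : 0 ≤ qH E := Finset.sum_nonneg fun f _ => by positivity
  have hk' : (0 : ℝ) < k := by exact_mod_cast hk
  have hsub : {ω : (V → Bool) × (V → ℝ) |
        ∀ f ∈ E, (∃ v ∈ f, C ω.1 ω.2 v = true) ∧ (∃ v ∈ f, C ω.1 ω.2 v = false)}ᶜ
      ⊆ Set.univ ×ˢ {w | ¬ Function.Injective w} ∪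
        ({ω | n < (freeVertices E ω.1 ω.2).card} ∪
          ⋃ e ∈ E, ⋃ f ∈ E, ⋃ b ∈ (univ : Finset Bool), {ω | Conflict E n e f b ω.1 ω.2}) := by
    rintro ⟨ic, w⟩ hω
    by_cases hw : Function.Injective w
    swap
    · exact Or.inl ⟨trivial, hw⟩
    refine Or.inr ?_
    by_cases hfree : n < (freeVertices E ic w).card
    · exact Or.inl hfree
    refine Or.inr ?_
    have hmono : ∃ f ∈ E, ∃ b, ∀ v ∈ f, C ic w v = b := by
      by_contra! hcon
      refine hω fun f hf => ⟨?_, ?_⟩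
      · obtain ⟨v, hv, h⟩ := hcon f hf false
        exact ⟨v, hv, by simpa using h⟩
      · obtain ⟨v, hv, h⟩ := hcon f hf true
        exact ⟨v, hv, by simpa using h⟩
    obtain ⟨f, hf, b, hb⟩ := hmono
    obtain ⟨e, he, hconf⟩ := exists_conflict_of_monochromatic (hC ic w hw) (not_lt.mp hfree) hf
      (Finset.card_pos.mp (hk.trans_le (hE f hf))) hb
    simp only [Set.mem_iUnion]
    exact ⟨e, he, f, hf, !b, Finset.mem_univ _, hconf⟩
  have hnull : muH V (Set.univ ×ˢ {w | ¬ Function.Injective w}) = 0 := by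
    have h := ae_injective_muW V
    rw [ae_iff] at h
    rw [muH, Measure.prod_prod, h, mul_zero]
  have hconf : muH V (⋃ e ∈ E, ⋃ f ∈ E, ⋃ b ∈ (univ : Finset Bool),
      {ω | Conflict E n e f b ω.1 ω.2}) ≤ ENNReal.ofReal (2 ^ n * qH E ^ 2 / k) := by
    calc _ ≤ ∑ e ∈ E, ∑ f ∈ E, ∑ b : Bool, muH V {ω | Conflict E n e f b ω.1 ω.2} := by
          refine (measure_biUnion_finset_le _ _).trans (Finset.sum_le_sum fun e _ => ?_)
          refine (measure_biUnion_finset_le _ _).trans (Finset.sum_le_sum fun f _ => ?_)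
          exact measure_biUnion_finset_le _ _
      _ ≤ ∑ e ∈ E, ∑ f ∈ E, ∑ b : Bool, ENNReal.ofReal
          (2 ^ n / 2 * (2 : ℝ) ^ (1 - (e.card : ℤ)) * (2 : ℝ) ^ (1 - (f.card : ℤ)) / k) := by
          refine Finset.sum_le_sum fun e he => Finset.sum_le_sum fun f _ =>
            Finset.sum_le_sum fun b _ => (muH_conflict_le E n e f b).trans ?_
          refine ENNReal.ofReal_le_ofReal ?_
          have : (k : ℝ) ≤ e.card := by exact_mod_cast hE e he
          gcongr
      _ = ENNReal.ofReal (∑ e ∈ E, ∑ f ∈ E, ∑ b : Bool,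
          (2 ^ n / 2 * (2 : ℝ) ^ (1 - (e.card : ℤ)) * (2 : ℝ) ^ (1 - (f.card : ℤ)) / k)) := by
          rw [ENNReal.ofReal_sum_of_nonneg fun e _ => by positivity]
          refine Finset.sum_congr rfl fun e _ => ?_
          rw [ENNReal.ofReal_sum_of_nonneg fun f _ => by positivity]
          refine Finset.sum_congr rfl fun f _ => ?_
          rw [ENNReal.ofReal_sum_of_nonneg fun b _ => by positivity]
      _ = _ := by
          congr 1
          rw [qH, sq, Finset.sum_mul_sum, Finset.mul_sum, Finset.sum_div]
          refine Finset.sum_congr rfl fun e _ => ?_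
          rw [Finset.mul_sum, Finset.sum_div]
          refine Finset.sum_congr rfl fun f _ => ?_
          rw [Finset.sum_const, Finset.card_univ, Fintype.card_bool, nsmul_eq_mul]
          push_cast
          ring
  calc _ ≤ _ := measure_mono hsub
    _ ≤ 0 + (ENNReal.ofReal (2 * qH E / n) + ENNReal.ofReal (2 ^ n * qH E ^ 2 / k)) := by
        refine (measure_union_le _ _).trans (add_le_add hnull.le ?_)
        exact (measure_union_le _ _).trans (add_le_add (muH_lt_card_freeVertices_le E hn) hconf)
    _ = _ := by rw [zero_add, ENNReal.ofReal_add (by positivity) (by positivity)]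

theorem two_pow_ceil_mul_sq_div_le {k : ℕ} (hk : 0 < k) {q : ℝ} (hq : 1 ≤ q)
    (hqk : q ≤ 1 / 24 * Real.log k) : 2 ^ ⌈6 * q⌉₊ * q ^ 2 / k ≤ 1 / 3 := by
  have hk' : (0 : ℝ) < k := by exact_mod_cast hk
  set L := Real.log k with hL
  have hkL : (k : ℝ) = Real.exp (L / 4) * Real.exp (3 * L / 4) := by
    rw [← Real.exp_add, ← Real.exp_log hk', ← hL]
    ring_nf
  have hpow : (2 : ℝ) ^ ⌈6 * q⌉₊ ≤ 2 * Real.exp (L / 4) := by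
    have hceil : (⌈6 * q⌉₊ : ℝ) ≤ 6 * q + 1 := (Nat.ceil_lt_add_one (by linarith)).le
    calc (2 : ℝ) ^ ⌈6 * q⌉₊ = (2 : ℝ) ^ (⌈6 * q⌉₊ : ℝ) := (Real.rpow_natCast _ _).symm
      _ ≤ (2 : ℝ) ^ (6 * q + 1) := Real.rpow_le_rpow_of_exponent_le (by norm_num) hceil
      _ = 2 * (2 : ℝ) ^ (6 * q) := by rw [Real.rpow_add two_pos, Real.rpow_one, mul_comm]
      _ ≤ 2 * Real.exp 1 ^ (6 * q) := by
          gcongr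
          linarith [Real.add_one_le_exp 1]
      _ = 2 * Real.exp (6 * q) := by rw [Real.exp_one_rpow]
      _ ≤ 2 * Real.exp (L / 4) := by gcongr; linarith
  have hexp := Real.quadratic_le_exp_of_nonneg (x := 3 * L / 4) (by linarith)
  have hq2 : q ^ 2 ≤ (1 / 24 * L) ^ 2 := by gcongr
  rw [div_le_iff₀ hk', hkL]
  calc 2 ^ ⌈6 * q⌉₊ * q ^ 2 ≤ 2 * Real.exp (L / 4) * (1 / 24 * L) ^ 2 := by gcongr
    _ = Real.exp (L / 4) * (2 * (1 / 24 * L) ^ 2) := by ring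
    _ ≤ Real.exp (L / 4) * (1 / 3 * Real.exp (3 * L / 4)) := by
        refine mul_le_mul_of_nonneg_left ?_ (Real.exp_pos _).le
        nlinarith [sq_nonneg L]
    _ = _ := by ring

/-- For every `ε > 0` there is `δ > 0` such that for all sufficiently large `k`, for every
hypergraph with `s_min(H) ≥ k` and `1 ≤ q(H) ≤ δ·log k`, the random two-phase coloring
produces a proper two coloring with probability at least `1/3 − ε`. -/
theorem two_phase_coloring_succeeds (ε : ℝ) (hε : 0 < ε) :
    ∃ δ : ℝ, 0 < δ ∧ ∃ k0 : ℕ, ∀ k : ℕ, k0 ≤ k →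
      ∀ (V : Type) [Fintype V] [DecidableEq V] (E : Finset (Finset V)),
        (∀ f ∈ E, 2 ≤ f.card) → (∀ f ∈ E, k ≤ f.card) →
        1 ≤ qH E → qH E ≤ δ * Real.log k →
        ∀ C : (V → Bool) → (V → ℝ) → (V → Bool),
          (∀ ic w, Function.Injective w → IsFinalColoring E ic w (C ic w)) →
          ENNReal.ofReal (1 / 3 - ε) ≤
            muH V {ω : (V → Bool) × (V → ℝ) |
              ∀ f ∈ E, (∃ v ∈ f, C ω.1 ω.2 v = true) ∧ (∃ v ∈ f, C ω.1 ω.2 v = false)} := by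
  refine ⟨1 / 24, by norm_num, 1, fun k hk V _ _ E _ hE hq1 hqk C hC => ?_⟩
  have hn : 0 < ⌈6 * qH E⌉₊ := Nat.ceil_pos.mpr (by linarith)
  have hfail := muH_not_proper_le hk hn hE hC
  have hdiv : 2 * qH E / ⌈6 * qH E⌉₊ ≤ 1 / 3 := by
    rw [div_le_iff₀ (by exact_mod_cast hn)]
    linarith [Nat.le_ceil (6 * qH E)]
  have hconf := two_pow_ceil_mul_sq_div_le hk hq1 hqk
  set S := {ω : (V → Bool) × (V → ℝ) |
    ∀ f ∈ E, (∃ v ∈ f, C ω.1 ω.2 v = true) ∧ (∃ v ∈ f, C ω.1 ω.2 v = false)}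
  have hfail' : muH V Sᶜ ≤ ENNReal.ofReal (2 / 3) :=
    hfail.trans (ENNReal.ofReal_le_ofReal (by linarith))
  have htotal : (1 : ENNReal) ≤ muH V S + muH V Sᶜ := by
    rw [← measure_univ (μ := muH V), ← Set.union_compl_self S]
    exact measure_union_le _ _
  have hsplit : ENNReal.ofReal (1 / 3) + ENNReal.ofReal (2 / 3) = 1 := by
    rw [← ENNReal.ofReal_add (by norm_num) (by norm_num)]
    norm_num
  refine (ENNReal.ofReal_le_ofReal (by linarith : 1 / 3 - ε ≤ 1 / 3)).trans ?_
  refine (ENNReal.add_le_add_iff_right (ENNReal.ofReal_ne_top (r := 2 / 3))).mp ?_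
  rw [hsplit]
  exact htotal.trans (add_le_add le_rfl hfail')
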